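/- Let X be a compact metric space, f : X → X a continuous map with the s-limit shadowing property, C a chain component of f, and D, E ∈ 𝒟(C). Then for any n ≥ 1, any x_1,…,x_n ∈ V^s(D), any y_1,…,y_n in the closure of V^s(E), and any ε > 0, there exist z_1,…,z_n in the closure of V^s(E) and integers K, L ≥ 0 such that d(y_j, z_j) ≤ ε for all 1 ≤ j ≤ n, and d(f^{K+i}(x_j), f^{L+i}(z_j)) ≤ ε for all 1 ≤ j ≤ n and all i ≥ 0. -/

import Mathlib

open Filter Metric Set Topology

section Defs

variable {X : Type*} [MetricSpace X]

/-- A δ-chain of `f` of length `k` (with `k ≥ 1`) within the set `C`, from `x` to `y`. -/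
def ChainIn (f : X → X) (C : Set X) (δ : ℝ) (k : ℕ) (x y : X) : Prop :=
  1 ≤ k ∧ ∃ c : ℕ → X, c 0 = x ∧ c k = y ∧ (∀ i ≤ k, c i ∈ C) ∧
    ∀ i < k, dist (f (c i)) (c (i + 1)) ≤ δ

/-- `x → y` : for every `δ > 0` there is a `δ`-chain of `f` from `x` to `y`. -/
def ChainReach (f : X → X) (x y : X) : Prop :=
  ∀ δ > 0, ∃ k, ChainIn f Set.univ δ k x y

/-- `x` is chain recurrent for `f`. -/
def ChainRecurrent (f : X → X) (x : X) : Prop := ChainReach f x x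

/-- `C` is a chain component of `f`: an equivalence class of the relation `↔`
on the set of chain recurrent points. -/
def IsChainComponent (f : X → X) (C : Set X) : Prop :=
  ∃ x, ChainRecurrent f x ∧
    C = {y | ChainRecurrent f y ∧ ChainReach f x y ∧ ChainReach f y x}

/-- The set of lengths of δ-cycles of `f` restricted to `C`. -/
def cycleLengths (f : X → X) (C : Set X) (δ : ℝ) : Set ℕ :=
  {k | ∃ x ∈ C, ChainIn f C δ k x x}

/-- The greatest common divisor of a set of natural numbers
(the greatest natural number dividing every element). -/
noncomputable def setGcd (S : Set ℕ) : ℕ := sSup {d | ∀ k ∈ S, d ∣ k}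

/-- `x ∼_{C,δ} y` : there is a δ-chain of `f|_C` from `x` to `y` whose length is
divisible by `m(C,δ)`, the gcd of the lengths of all δ-cycles of `f|_C`. -/
def SimCd (f : X → X) (C : Set X) (δ : ℝ) (x y : X) : Prop :=
  ∃ k, setGcd (cycleLengths f C δ) ∣ k ∧ ChainIn f C δ k x y

/-- `x ∼_C y` : `x ∼_{C,δ} y` for all `δ > 0`. -/
def SimC (f : X → X) (C : Set X) (x y : X) : Prop :=
  ∀ δ > 0, SimCd f C δ x y

/-- `𝒟(C,δ)` : the set of equivalence classes of `∼_{C,δ}`. -/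
def DClassesd (f : X → X) (C : Set X) (δ : ℝ) : Set (Set X) :=
  {D | ∃ x ∈ C, D = {y ∈ C | SimCd f C δ x y}}

/-- `𝒟(C)` : the set of equivalence classes of `∼_C`. -/
def DClasses (f : X → X) (C : Set X) : Set (Set X) :=
  {D | ∃ x ∈ C, D = {y ∈ C | SimC f C x y}}

/-- `W^s(C) = {x : lim_{i→∞} d(f^i(x), C) = 0}`. -/
def wStable (f : X → X) (C : Set X) : Set X :=
  {x | Tendsto (fun i => infDist (f^[i] x) C) atTop (nhds 0)}

/-- `V^s(D) = ⋂_{δ>0} {x ∈ W^s(C) : lim_{i→∞} d(f^i(x), f^i(D_δ)) = 0}`, where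
`D_δ` is the unique element of `𝒟(C,δ)` containing `D`. -/
def vStable (f : X → X) (C D : Set X) : Set X :=
  {x | x ∈ wStable f C ∧ ∀ δ > 0, ∀ Dd ∈ DClassesd f C δ, D ⊆ Dd →
    Tendsto (fun i => infDist (f^[i] x) (f^[i] '' Dd)) atTop (nhds 0)}

/-- The s-limit shadowing property. -/
def SLimitShadowing (f : X → X) : Prop :=
  ∀ ε > 0, ∃ δ > 0, ∀ x : ℕ → X,
    (∀ i, dist (f (x i)) (x (i + 1)) ≤ δ) →
    Tendsto (fun i => dist (f (x i)) (x (i + 1))) atTop (nhds 0) →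
    ∃ z : X, (∀ i, dist (f^[i] z) (x i) ≤ ε) ∧
      Tendsto (fun i => dist (f^[i] z) (x i)) atTop (nhds 0)

/-- The limit shadowing property. -/
def LimitShadowing (f : X → X) : Prop :=
  ∀ x : ℕ → X, Tendsto (fun i => dist (f (x i)) (x (i + 1))) atTop (nhds 0) →
    ∃ z : X, Tendsto (fun i => dist (f^[i] z) (x i)) atTop (nhds 0)

/-- The (plain) shadowing property. -/
def ShadowingProperty (f : X → X) : Prop :=
  ∀ ε > 0, ∃ δ > 0, ∀ x : ℕ → X, (∀ i, dist (f (x i)) (x (i + 1)) ≤ δ) →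
    ∃ z : X, ∀ i, dist (f^[i] z) (x i) ≤ ε

/-- A Furstenberg family: hereditary upward and proper. -/
def FurstenbergFamily (F : Set (Set ℕ)) : Prop :=
  (∀ A B : Set ℕ, A ∈ F → A ⊆ B → B ∈ F) ∧ F.Nonempty ∧ F ≠ Set.univ

/-- A full Furstenberg family. -/
def FullFamily (F : Set (Set ℕ)) : Prop :=
  ∀ A ∈ F, ∀ n : ℕ, {i ∈ A | n ≤ i} ∈ F

/-- A translation invariant Furstenberg family. -/
def TranslationInvariantFamily (F : Set (Set ℕ)) : Prop :=
  ∀ A ∈ F, ∀ n : ℕ, ((fun i => i + n) '' A ∈ F ∧ {i | i + n ∈ A} ∈ F)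

/-- `S_f(x₁,…,xₙ; r) = {i : min_{j<k} d(fⁱ(x_j), fⁱ(x_k)) > r}`. -/
def Sset (f : X → X) {n : ℕ} (x : Fin n → X) (r : ℝ) : Set ℕ :=
  {i | ∀ j k : Fin n, j < k → r < dist (f^[i] (x j)) (f^[i] (x k))}

/-- `T_f(x₁,…,xₙ; r) = {i : max_{j<k} d(fⁱ(x_j), fⁱ(x_k)) < r}`. -/
def Tset (f : X → X) {n : ℕ} (x : Fin n → X) (r : ℝ) : Set ℕ :=
  {i | ∀ j k : Fin n, j < k → dist (f^[i] (x j)) (f^[i] (x k)) < r}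

/-- `(x₁,…,xₙ)` is an `(ℱ,𝒢)`-δ-scrambled n-tuple for `f`. -/
def Scrambled (f : X → X) (F G : Set (Set ℕ)) (δ : ℝ) {n : ℕ} (x : Fin n → X) : Prop :=
  Sset f x δ ∈ F ∧ ∀ ε > 0, Tset f x ε ∈ G

/-- `Y` is dense `(ℱ,𝒢)`-n-δ-chaotic for `f`: the `(ℱ,𝒢)`-δ-scrambled n-tuples in `Yⁿ`
form a dense subset of `Yⁿ`. -/
def DenseChaotic (f : X → X) (F G : Set (Set ℕ)) (n : ℕ) (δ : ℝ) (Y : Set X) : Prop :=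
  {x : Fin n → X | ∀ j, x j ∈ Y} ⊆
    closure {x : Fin n → X | (∀ j, x j ∈ Y) ∧ Scrambled f F G δ x}

/-- `S` is a residual subset of the subspace `T`: it contains a countable intersection of
dense open subsets of `T`. -/
def ResidualIn {α : Type*} [TopologicalSpace α] (T S : Set α) : Prop :=
  ∃ U : ℕ → Set α, (∀ i, IsOpen (U i)) ∧ (∀ i, T ⊆ closure (U i ∩ T)) ∧
    (⋂ i, U i) ∩ T ⊆ S

/-- `Y` is generic `(ℱ,𝒢)`-n-δ-chaotic for `f`: the `(ℱ,𝒢)`-δ-scrambled n-tuples in `Yⁿ`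
form a residual subset of `Yⁿ`. -/
def GenericChaotic (f : X → X) (F G : Set (Set ℕ)) (n : ℕ) (δ : ℝ) (Y : Set X) : Prop :=
  ResidualIn {x : Fin n → X | ∀ j, x j ∈ Y}
    {x : Fin n → X | (∀ j, x j ∈ Y) ∧ Scrambled f F G δ x}

/-- A Furstenberg family `F` is compatible with `(Z, g)`. -/
def CompatibleFamily {Z : Type*} [TopologicalSpace Z] (F : Set (Set ℕ)) (g : Z → Z) : Prop :=
  ∀ U : Set Z, IsOpen U → IsGδ {z | {i | g^[i] z ∈ U} ∈ F}

end Defs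

section Chains

variable {X : Type*} [MetricSpace X] {f : X → X} {C : Set X} {δ : ℝ}

theorem ChainIn.mono {C' : Set X} {δ' : ℝ} {k : ℕ} {x y : X} (h : ChainIn f C δ k x y)
    (hC : C ⊆ C') (hδ : δ ≤ δ') : ChainIn f C' δ' k x y := by
  obtain ⟨hk, c, h0, h1, hc, hs⟩ := h
  exact ⟨hk, c, h0, h1, fun i hi => hC (hc i hi), fun i hi => (hs i hi).trans hδ⟩

theorem ChainIn.trans {k l : ℕ} {x y z : X} (h : ChainIn f C δ k x y)
    (h' : ChainIn f C δ l y z) : ChainIn f C δ (k + l) x z := by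
  obtain ⟨hk, c, h0, h1, hc, hs⟩ := h
  obtain ⟨hl, c', h0', h1', hc', hs'⟩ := h'
  refine ⟨by omega, fun i => if i < k then c i else c' (i - k), ?_, ?_, ?_, ?_⟩
  · simp [show 0 < k by omega, h0]
  · simp [h1']
  · intro i hi
    by_cases hik : i < k
    · simpa [hik] using hc i hik.le
    · simpa [hik] using hc' (i - k) (by omega)
  · intro i hi
    by_cases hik : i + 1 < k
    · simpa [hik, show i < k by omega] using hs i (by omega)
    · by_cases hik' : i < k
      · have : i + 1 = k := by omega
        have := hs i hik'
        simp_all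
      · have := hs' (i - k) (by omega)
        simpa [hik, hik', show i + 1 - k = i - k + 1 by omega] using this

theorem ChainIn.left_mem {k : ℕ} {x y : X} (h : ChainIn f C δ k x y) : x ∈ C := by
  obtain ⟨_, c, h0, _, hc, _⟩ := h
  exact h0 ▸ hc 0 (Nat.zero_le _)

theorem ChainIn.right_mem {k : ℕ} {x y : X} (h : ChainIn f C δ k x y) : y ∈ C := by
  obtain ⟨_, c, _, h1, hc, _⟩ := h
  exact h1 ▸ hc k le_rfl

theorem ChainIn.perturb_right {k : ℕ} {x y y' : X} {η : ℝ} (h : ChainIn f C δ k x y)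
    (hy' : y' ∈ C) (hη : dist y y' ≤ η) : ChainIn f C (δ + η) k x y' := by
  obtain ⟨hk, c, h0, h1, hc, hs⟩ := h
  have hη0 : 0 ≤ η := dist_nonneg.trans hη
  refine ⟨hk, fun i => if i = k then y' else c i, ?_, ?_, ?_, ?_⟩
  · simp [show 0 ≠ k by omega, h0]
  · simp
  · intro i hi
    by_cases hik : i = k
    · simpa [hik] using hy'
    · simpa [hik] using hc i hi
  · intro i hi
    by_cases hik : i + 1 = k
    · have h2 := hs i hi
      rw [hik, h1] at h2
      simp only [hi.ne, hik, if_true, if_false]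
      linarith [dist_triangle (f (c i)) y y']
    · simp only [hi.ne, hik, if_false]
      linarith [hs i hi]

theorem ChainIn.perturb_left {k : ℕ} {x x' y : X} {η : ℝ} (h : ChainIn f C δ k x y)
    (hx' : x' ∈ C) (hη : dist (f x') (f x) ≤ η) : ChainIn f C (δ + η) k x' y := by
  obtain ⟨hk, c, h0, h1, hc, hs⟩ := h
  have hη0 : 0 ≤ η := dist_nonneg.trans hη
  refine ⟨hk, fun i => if i = 0 then x' else c i, ?_, ?_, ?_, ?_⟩
  · simp
  · simp [show k ≠ 0 by omega, h1]
  · intro i hi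
    by_cases hik : i = 0
    · simpa [hik] using hx'
    · simpa [hik] using hc i hi
  · intro i hi
    by_cases hik : i = 0
    · subst hik
      have h2 := hs 0 hi
      rw [h0] at h2
      simp only [if_true, Nat.succ_ne_zero, if_false]
      linarith [dist_triangle (f x') (f x) (c (0 + 1))]
    · simp only [hik, Nat.succ_ne_zero, if_false]
      linarith [hs i hi]

theorem chainIn_iterate (hC : MapsTo f C C) (hδ : 0 ≤ δ) {x : X} (hx : x ∈ C) {k : ℕ}
    (hk : 1 ≤ k) : ChainIn f C δ k x (f^[k] x) :=
  ⟨hk, fun i => f^[i] x, rfl, rfl, fun i _ => hC.iterate i hx, fun i _ => by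
    simpa [Function.iterate_succ_apply'] using hδ⟩

theorem ChainReach.trans {x y z : X} (h : ChainReach f x y) (h' : ChainReach f y z) :
    ChainReach f x z := fun δ hδ => by
  obtain ⟨k, hk⟩ := h δ hδ
  obtain ⟨l, hl⟩ := h' δ hδ
  exact ⟨k + l, hk.trans hl⟩

theorem IsChainComponent.chainReach (hC : IsChainComponent f C) {x y : X} (hx : x ∈ C)
    (hy : y ∈ C) : ChainReach f x y := by
  obtain ⟨p, _, rfl⟩ := hC
  exact hx.2.2.trans hy.2.1

theorem IsChainComponent.mem_of_chainReach (hC : IsChainComponent f C) {x y w : X} (hx : x ∈ C)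
    (hy : y ∈ C) (hxw : ChainReach f x w) (hwy : ChainReach f w y) : w ∈ C := by
  have hyx := hC.chainReach hy hx
  obtain ⟨p, _, rfl⟩ := hC
  exact ⟨(hwy.trans hyx).trans hxw, hx.2.1.trans hxw, hwy.trans hy.2.2⟩

theorem IsChainComponent.mapsTo (hC : IsChainComponent f C) (hf : Continuous f) :
    MapsTo f C C := by
  intro x hx
  refine hC.mem_of_chainReach hx hx (fun δ hδ => ⟨1, ?_⟩) (fun δ hδ => ?_)
  · exact chainIn_iterate (mapsTo_univ _ _) hδ.le (mem_univ x) le_rfl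
  · obtain ⟨η, hη, hfη⟩ := Metric.continuous_iff.1 hf (f x) (δ / 2) (by positivity)
    obtain ⟨k, hk⟩ := hC.chainReach hx hx (min (δ / 2) (η / 2)) (by positivity)
    obtain ⟨hk2, c, h0, h1, -, hs⟩ := hk.trans hk
    have hk1 := hk.1
    have hc : ChainIn f univ (δ / 2) (k + k - 1) (c 1) x :=
      ⟨by omega, fun i => c (i + 1), rfl, by simpa [show k + k - 1 + 1 = k + k by omega] using h1,
        fun _ _ => mem_univ _, fun i hi => (hs (i + 1) (by omega)).trans (min_le_left _ _)⟩
    have hd : dist (c 1) (f x) < η := by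
      have := (hs 0 (by omega)).trans (min_le_right _ _)
      rw [h0, dist_comm, zero_add] at this
      linarith
    have := hc.perturb_left (mem_univ (f x)) ((dist_comm (f (f x)) _ ▸ (hfη _ hd).le))
    exact ⟨_, this.mono Subset.rfl (by linarith)⟩

theorem IsChainComponent.exists_chain_near [CompactSpace X] (hC : IsChainComponent f C)
    (hf : Continuous f) {p q : X} (hp : p ∈ C) (hq : q ∈ C) {r : ℝ} (hr : 0 < r) :
    ∃ η > 0, ∀ w k l, ChainIn f univ η k p w → ChainIn f univ η l w q → infDist w C < r := by
  by_contra! hcon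
  have hpos : ∀ n : ℕ, (0 : ℝ) < 1 / (n + 1) := fun n => Nat.one_div_pos_of_nat
  choose w k l hk hl hw using fun n : ℕ => hcon _ (hpos n)
  obtain ⟨a, -, φ, hφ, ha⟩ := isCompact_univ.tendsto_subseq (fun n => mem_univ (w n))
  have hφ0 : Tendsto (fun n => (1 : ℝ) / (φ n + 1)) atTop (𝓝 0) :=
    (tendsto_one_div_add_atTop_nhds_zero_nat (𝕜 := ℝ)).comp hφ.tendsto_atTop
  have haC : a ∈ C := by
    refine hC.mem_of_chainReach hp hq (fun δ hδ => ?_) (fun δ hδ => ?_)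
    · have h1 := Metric.tendsto_nhds.1 ha (δ / 2) (by positivity)
      have h2 := hφ0.eventually_lt_const (show (0 : ℝ) < δ / 2 by positivity)
      obtain ⟨n, h1, h2⟩ := (h1.and h2).exists
      exact ⟨_, ((hk (φ n)).perturb_right (mem_univ a) h1.le).mono Subset.rfl (by linarith)⟩
    · have h1 := Metric.tendsto_nhds.1 ((hf.tendsto a).comp ha) (δ / 2) (by positivity)
      have h2 := hφ0.eventually_lt_const (show (0 : ℝ) < δ / 2 by positivity)
      obtain ⟨n, h1, h2⟩ := (h1.and h2).exists
      rw [dist_comm] at h1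
      exact ⟨_, ((hl (φ n)).perturb_left (mem_univ a) h1.le).mono Subset.rfl (by linarith)⟩
  have hlim : Tendsto (fun n => infDist (w (φ n)) C) atTop (𝓝 (infDist a C)) :=
    ((continuous_infDist_pt C).tendsto a).comp ha
  have := ge_of_tendsto' hlim (fun n => hw (φ n))
  rw [infDist_zero_of_mem haC] at this
  linarith

theorem IsChainComponent.exists_chainIn [CompactSpace X] (hC : IsChainComponent f C)
    (hf : Continuous f) {p q : X} (hp : p ∈ C) (hq : q ∈ C) (hδ : 0 < δ) :
    ∃ k, ChainIn f C δ k p q := by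
  obtain ⟨r, hr, hfr⟩ := Metric.uniformContinuous_iff.1
    (CompactSpace.uniformContinuous_of_continuous hf) (δ / 3) (by positivity)
  set s := min r (δ / 3)
  have hs : 0 < s := by positivity
  obtain ⟨η, hη, hnear⟩ := hC.exists_chain_near hf hp hq hs
  obtain ⟨k, hk, c, h0, h1, -, hc⟩ := hC.chainReach hp hq (min η (δ / 3)) (by positivity)
  have key : ∀ i ≤ k, ∃ a ∈ C, dist (c i) a < s ∧ (i = 0 → a = p) ∧ (i = k → a = q) := by
    intro i hi
    by_cases hi0 : i = 0
    · exact ⟨p, hp, by simpa [hi0, h0] using hs, fun _ => rfl, by omega⟩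
    by_cases hik : i = k
    · exact ⟨q, hq, by simpa [hik, h1] using hs, by omega, fun _ => rfl⟩
    have hlt : infDist (c i) C < s := by
      refine hnear _ i (k - i) ⟨by omega, c, h0, rfl, fun _ _ => mem_univ _, fun j hj =>
        (hc j (by omega)).trans (min_le_left _ _)⟩ ⟨by omega, fun j => c (i + j), rfl, ?_,
        fun _ _ => mem_univ _, fun j hj => (hc (i + j) (by omega)).trans (min_le_left _ _)⟩
      simpa [show i + (k - i) = k by omega] using h1
    obtain ⟨a, ha, had⟩ := (infDist_lt_iff ⟨p, hp⟩).1 hlt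
    exact ⟨a, ha, had, fun h => absurd h hi0, fun h => absurd h hik⟩
  have : Nonempty X := ⟨p⟩
  choose! a haC had ha0 hak using key
  refine ⟨k, hk, a, ha0 0 (by omega) rfl, hak k le_rfl rfl, haC, fun i hi => ?_⟩
  have e1 := (hc i hi).trans (min_le_right _ _)
  have e2 := (had (i + 1) hi).trans_le (min_le_right _ _)
  have e3 := hfr ((had i hi.le).trans_le (min_le_left _ _))
  rw [dist_comm] at e3
  linarith [dist_triangle4 (f (a i)) (f (c i)) (c (i + 1)) (a (i + 1))]

theorem setGcd_eq_natSetGcd {S : Set ℕ} (hS : ∃ k ∈ S, k ≠ 0) : setGcd S = Nat.setGcd S := by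
  have h0 : Nat.setGcd S ≠ 0 := by
    rw [Ne, Nat.setGcd_eq_zero_iff]
    obtain ⟨k, hk, hk0⟩ := hS
    exact fun h => hk0 (h hk)
  refine IsGreatest.csSup_eq ⟨fun k hk => Nat.setGcd_dvd_of_mem hk, fun d hd => ?_⟩
  exact Nat.le_of_dvd (Nat.pos_of_ne_zero h0) (Nat.dvd_setGcd_iff.2 hd)

theorem setGcd_cycleLengths_dvd {k : ℕ} {p : X} (h : ChainIn f C δ k p p) :
    setGcd (cycleLengths f C δ) ∣ k := by
  have hk : k ∈ cycleLengths f C δ := ⟨p, h.left_mem, h⟩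
  rw [setGcd_eq_natSetGcd ⟨k, hk, by have := h.1; omega⟩]
  exact Nat.setGcd_dvd_of_mem hk

theorem setGcd_cycleLengths_pos {k : ℕ} {p : X} (h : ChainIn f C δ k p p) :
    0 < setGcd (cycleLengths f C δ) :=
  Nat.pos_of_dvd_of_pos (setGcd_cycleLengths_dvd h) h.1

theorem exists_forall_ge_cycle (hconn : ∀ p ∈ C, ∀ q ∈ C, ∃ k, ChainIn f C δ k p q)
    {p : X} (hp : p ∈ C) :
    ∃ P, ∀ k ≥ P, setGcd (cycleLengths f C δ) ∣ k → ChainIn f C δ k p p := by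
  obtain ⟨k₀, hk₀⟩ := hconn p hp p hp
  set S : Set ℕ := {k | ChainIn f C δ k p p}
  have hdvd : Nat.setGcd S ∣ setGcd (cycleLengths f C δ) := by
    rw [setGcd_eq_natSetGcd ⟨k₀, (⟨p, hp, hk₀⟩ : k₀ ∈ cycleLengths f C δ), by have := hk₀.1; omega⟩, Nat.dvd_setGcd_iff]
    rintro l ⟨q, hq, hl⟩
    obtain ⟨a, ha⟩ := hconn p hp q hq
    obtain ⟨b, hb⟩ := hconn q hq p hp
    have h1 : Nat.setGcd S ∣ a + b := Nat.setGcd_dvd_of_mem (ha.trans hb)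
    have h2 : Nat.setGcd S ∣ a + l + b := Nat.setGcd_dvd_of_mem ((ha.trans hl).trans hb)
    rw [show a + l + b = a + b + l by ring] at h2
    exact (Nat.dvd_add_right h1).1 h2
  obtain ⟨P, hP⟩ := Nat.exists_mem_closure_of_ge S
  refine ⟨P + 1, fun k hk hd => ?_⟩
  have hmem : ∀ l ∈ AddSubmonoid.closure S, l = 0 ∨ ChainIn f C δ l p p := by
    intro l hl
    induction hl using AddSubmonoid.closure_induction with
    | mem x hx => exact Or.inr hx
    | zero => exact Or.inl rfl
    | add x y _ _ hx hy =>
      rcases hx with rfl | hx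
      · simpa using hy
      · rcases hy with rfl | hy
        · exact Or.inr hx
        · exact Or.inr (hx.trans hy)
  exact (hmem k (hP k (by omega) (hdvd.trans hd))).resolve_left (by omega)

theorem ChainIn.modEq (hconn : ∀ p ∈ C, ∀ q ∈ C, ∃ k, ChainIn f C δ k p q) {k l : ℕ} {p q : X}
    (hk : ChainIn f C δ k p q) (hl : ChainIn f C δ l p q) :
    k ≡ l [MOD setGcd (cycleLengths f C δ)] := by
  obtain ⟨b, hb⟩ := hconn q hk.right_mem p hk.left_mem
  have h1 := (Nat.modEq_zero_iff_dvd.2 (setGcd_cycleLengths_dvd (hk.trans hb)))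
  have h2 := (Nat.modEq_zero_iff_dvd.2 (setGcd_cycleLengths_dvd (hl.trans hb)))
  exact (h1.trans h2.symm).add_right_cancel' b

theorem IsChainComponent.exists_forall_ge_chainIn [CompactSpace X] (hC : IsChainComponent f C)
    (hf : Continuous f) (hδ : 0 < δ) {p : X} (hp : p ∈ C) :
    ∃ P, ∀ q ∈ C, ∀ k l, ChainIn f C δ l p q →
      k ≡ l [MOD setGcd (cycleLengths f C δ)] → P ≤ k → ChainIn f C δ k p q := by
  have hconn : ∀ p ∈ C, ∀ q ∈ C, ∃ k, ChainIn f C δ k p q :=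
    fun p hp q hq => hC.exists_chainIn hf hp hq hδ
  obtain ⟨P, hP⟩ := exists_forall_ge_cycle hconn hp
  obtain ⟨t, htC, htf, ht⟩ := finite_approx_of_totallyBounded
    (isCompact_univ.totallyBounded.subset (subset_univ C)) (δ / 2) (by positivity)
  choose! a ha using fun q (hq : q ∈ C) =>
    hC.exists_chainIn hf (δ := δ / 2) hp hq (by positivity)
  obtain ⟨A, hA⟩ := (htf.image a).bddAbove
  refine ⟨P + A, fun q hq k l hl hkl hk => ?_⟩
  obtain ⟨b, hbt, hqb⟩ := mem_iUnion₂.1 (ht hq)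
  rw [mem_ball, dist_comm] at hqb
  have hc : ChainIn f C δ (a b) p q := by
    simpa using (ha b (htC hbt)).perturb_right hq hqb.le
  have hab : a b ≤ A := hA ⟨b, hbt, rfl⟩
  have hd : setGcd (cycleLengths f C δ) ∣ k - a b :=
    (Nat.modEq_iff_dvd' (by omega)).1 ((hc.modEq hconn hl).trans hkl.symm)
  have := (hP (k - a b) (by omega) hd).trans hc
  rwa [Nat.sub_add_cancel (by omega)] at this

theorem exists_glue {u v : ℕ → X} {t : ℕ} {η : ℝ}
    (hu : ∀ i < t, dist (f (u i)) (u (i + 1)) ≤ η / 2) (huv : dist (u t) (v 0) ≤ η / 2)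
    (hv : ∀ i, dist (f (v i)) (v (i + 1)) ≤ η) :
    ∃ w : ℕ → X, (∀ i < t, w i = u i) ∧ (∀ i, w (t + i) = v i) ∧
      ∀ i, dist (f (w i)) (w (i + 1)) ≤ η := by
  have hη : 0 ≤ η / 2 := dist_nonneg.trans huv
  refine ⟨fun i => if i < t then u i else v (i - t), fun i hi => by simp [hi],
    fun i => by simp, fun i => ?_⟩
  by_cases hi : i + 1 < t
  · simp only [hi, show i < t by omega, if_true]
    linarith [hu i (by omega)]
  by_cases hi' : i < t
  · obtain rfl : i + 1 = t := by omega
    simp only [hi', lt_irrefl, if_true, if_false, Nat.sub_self]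
    linarith [hu i hi', dist_triangle (f (u i)) (u (i + 1)) (v 0)]
  · simpa [hi, hi', show i + 1 - t = i - t + 1 by omega] using hv (i - t)

theorem mem_vStable_of_tendsto {D : Set X} {x z : X} (hx : x ∈ vStable f C D)
    (h : Tendsto (fun i => dist (f^[i] z) (f^[i] x)) atTop (𝓝 0)) : z ∈ vStable f C D := by
  have key : ∀ S : ℕ → Set X, Tendsto (fun i => infDist (f^[i] x) (S i)) atTop (𝓝 0) →
      Tendsto (fun i => infDist (f^[i] z) (S i)) atTop (𝓝 0) := fun S hS =>
    squeeze_zero (fun _ => infDist_nonneg) (fun _ => infDist_le_infDist_add_dist)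
      (by simpa using hS.add h)
  exact ⟨key _ hx.1, fun δ hδ Dd hDd hD => key _ (hx.2 δ hδ Dd hDd hD)⟩

/-- Points of `V^s(D)` are eventually shadowed by the orbits of points at which a cyclic phase of
`f|_C` agrees with that of a representative `d` of `D`. -/
theorem eventually_exists_simCd (hconn : ∀ p ∈ C, ∀ q ∈ C, ∃ k, ChainIn f C δ k p q)
    (hδ : 0 < δ) {d : X} (hd : d ∈ C) {x : X} (hx : x ∈ vStable f C {y ∈ C | SimC f C d y})
    {η : ℝ} (hη : 0 < η) :
    ∀ᶠ i in atTop, ∃ e, SimCd f C δ d e ∧ dist (f^[i] x) (f^[i] e) < η := by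
  have ht := hx.2 δ hδ {y ∈ C | SimCd f C δ d y} ⟨d, hd, rfl⟩ (fun y hy => ⟨hy.1, hy.2 δ hδ⟩)
  filter_upwards [ht.eventually_lt_const hη] with i hi
  obtain ⟨k, hk⟩ := hconn d hd d hd
  have hne : (f^[i] '' {y ∈ C | SimCd f C δ d y}).Nonempty :=
    Set.Nonempty.image _ ⟨d, hd, k, setGcd_cycleLengths_dvd hk, hk⟩
  obtain ⟨_, ⟨e, he, rfl⟩, hlt⟩ := (infDist_lt_iff hne).1 hi
  exact ⟨e, he.2, hlt⟩

theorem SimCd.right_mem {x y : X} (h : SimCd f C δ x y) : y ∈ C := by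
  obtain ⟨_, _, h⟩ := h
  exact h.right_mem

theorem modEq_of_chainIn_iterate (hconn : ∀ p ∈ C, ∀ q ∈ C, ∃ k, ChainIn f C δ k p q)
    (hmaps : MapsTo f C C) (hδ : 0 ≤ δ) {a₀ a b₀ b : X} (ha : SimCd f C δ a₀ a)
    (hb : SimCd f C δ b₀ b) {r l N T : ℕ} (hr : ChainIn f C δ r a₀ b₀) (hN : 1 ≤ N) (hT : 1 ≤ T)
    (hl : ChainIn f C δ l (f^[N] a) (f^[T] b)) :
    N + l ≡ r + T [MOD setGcd (cycleLengths f C δ)] := by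
  have hNa := chainIn_iterate hmaps hδ ha.right_mem hN
  have hTb := chainIn_iterate hmaps hδ hb.right_mem hT
  obtain ⟨k, hk, hka⟩ := ha
  obtain ⟨k', hk', hkb⟩ := hb
  have h := ((hka.trans hNa).trans hl).modEq hconn ((hr.trans hkb).trans hTb)
  have hk0 : k ≡ k' [MOD setGcd (cycleLengths f C δ)] :=
    (Nat.modEq_zero_iff_dvd.2 hk).trans (Nat.modEq_zero_iff_dvd.2 hk').symm
  refine hk0.add_left_cancel ?_
  rwa [show k + (N + l) = k + N + l by ring, show k' + (r + T) = r + k' + T by ring]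

/-- The pseudo-orbit that follows `y` for time `N`, a chain of length `A`, the point `f^[K] x` up to
time `M`, a chain of length `B`, and finally the orbit of `f^[T] y`. -/
theorem exists_pseudoOrbit {η : ℝ} {N A K M B T : ℕ} {x y a b a' b' : X}
    (hya : dist (f^[N] y) a ≤ η / 2) (hA : ChainIn f C (η / 2) A a b)
    (hbx : dist b (f^[K] x) ≤ η / 2) (hxa' : dist (f^[K + (M + 1)] x) a' ≤ η / 2)
    (hB : ChainIn f C (η / 2) B a' b') (hby : dist b' (f^[T] y) ≤ η / 2) :
    ∃ w : ℕ → X, (∀ i < N, w i = f^[i] y) ∧ (∀ i ≤ M, w (N + (A + i)) = f^[K + i] x) ∧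
      (∀ i, w (N + (A + (M + 1 + (B + i)))) = f^[T + i] y) ∧
      ∀ i, dist (f (w i)) (w (i + 1)) ≤ η := by
  have hη : 0 ≤ η / 2 := dist_nonneg.trans hya
  have horb : ∀ (p : X) (n i : ℕ), dist (f (f^[n + i] p)) (f^[n + (i + 1)] p) ≤ η / 2 :=
    fun p n i => by simpa [← add_assoc, Function.iterate_succ_apply'] using hη
  obtain ⟨hA1, c, hc0, hc1, -, hc⟩ := hA
  obtain ⟨hB1, c', hc0', hc1', -, hc'⟩ := hB
  obtain ⟨w₄, h4, h4', hs4⟩ := exists_glue (v := fun i => f^[T + i] y) hc'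
    (by rw [hc1']; exact hby) (fun i => (horb y T i).trans (by linarith))
  have h40 : w₄ 0 = a' := (h4 0 hB1).trans hc0'
  obtain ⟨w₃, h3, h3', hs3⟩ := exists_glue (u := fun i => f^[K + i] x) (t := M + 1)
    (fun i _ => horb x K i) (by rw [h40]; exact hxa') hs4
  obtain ⟨w₂, h2, h2', hs2⟩ := exists_glue (v := w₃) hc
    (by rw [hc1, h3 0 (by omega)]; exact hbx) hs3
  have h20 : w₂ 0 = a := (h2 0 hA1).trans hc0
  obtain ⟨w₁, h1, h1', hs1⟩ := exists_glue (u := fun i => f^[i] y) (t := N)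
    (fun i _ => by simpa using horb y 0 i) (by rw [h20]; exact hya) hs2
  refine ⟨w₁, h1, fun i hi => ?_, fun i => ?_, hs1⟩
  · rw [h1', h2', h3 i (by omega)]
  · rw [h1', h2', h3', h4']

end Chains

/-- Lemma 3.1: under s-limit shadowing, points of `[V^s(D)]ⁿ` can be
simultaneously ε-traced, after time shifts, by points near any given points of
`closure (V^s(E))`. -/
theorem simultaneous_tracing_lemma
    {X : Type*} [MetricSpace X] [CompactSpace X]
    (f : X → X) (hf : Continuous f) (hsls : SLimitShadowing f)
    (C : Set X) (hC : IsChainComponent f C)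
    (D : Set X) (hD : D ∈ DClasses f C) (E : Set X) (hE : E ∈ DClasses f C)
    (n : ℕ) (hn : 1 ≤ n) (x y : Fin n → X)
    (hx : ∀ j, x j ∈ vStable f C D) (hy : ∀ j, y j ∈ closure (vStable f C E))
    (ε : ℝ) (hε : 0 < ε) :
    ∃ z : Fin n → X, ∃ K L : ℕ,
      (∀ j, z j ∈ closure (vStable f C E)) ∧
      (∀ j, dist (y j) (z j) ≤ ε) ∧
      (∀ j, ∀ i : ℕ, dist (f^[K + i] (x j)) (f^[L + i] (z j)) ≤ ε) := by
  have hmaps := hC.mapsTo hf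
  obtain ⟨δ, hδ, hshadow⟩ := hsls (ε / 2) (by positivity)
  have hδ2 : 0 < δ / 2 := by positivity
  have hconn : ∀ p ∈ C, ∀ q ∈ C, ∃ k, ChainIn f C (δ / 2) k p q :=
    fun p hp q hq => hC.exists_chainIn hf hp hq hδ2
  obtain ⟨d₀, hd₀, rfl⟩ := hD
  obtain ⟨e₀, he₀, rfl⟩ := hE
  obtain ⟨r, hr⟩ := hconn e₀ he₀ d₀ hd₀
  obtain ⟨r', hr'⟩ := hconn d₀ hd₀ e₀ he₀
  set m := setGcd (cycleLengths f C (δ / 2))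
  have hm0 : 0 < m := setGcd_cycleLengths_pos (hr.trans hr')
  have hrr : r + r' ≡ 0 [MOD m] :=
    Nat.modEq_zero_iff_dvd.2 (setGcd_cycleLengths_dvd (hr.trans hr'))
  choose y' hy'V hyy' using fun j => Metric.mem_closure_iff.1 (hy j) (ε / 2) (by positivity)
  obtain ⟨N, hN⟩ := eventually_atTop.1
    ((eventually_all.2 fun j => eventually_exists_simCd hconn hδ2 hd₀ (hx j) hδ2).and
      (eventually_all.2 fun j => eventually_exists_simCd hconn hδ2 he₀ (hy'V j) hδ2))
  replace hN := fun i (hi : N + 1 ≤ i) => hN i (by omega)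
  set N := N + 1
  have hN1 : 1 ≤ N := by omega
  choose d hd hxd using (hN N le_rfl).1
  choose e he hye using (hN N le_rfl).2
  choose P hP using fun j =>
    hC.exists_forall_ge_chainIn hf hδ2 (hmaps.iterate N (he j).right_mem)
  set A := r + m * ∑ j, P j with hA
  have hAr : A ≡ r [MOD m] := by simp [hA, Nat.ModEq]
  have hAP : ∀ j, P j ≤ A := fun j => by
    have h1 := Finset.single_le_sum (fun i _ => Nat.zero_le (P i)) (Finset.mem_univ j)
    have h2 := Nat.le_mul_of_pos_left (∑ j, P j) hm0
    omega
  have hchain : ∀ j, ChainIn f C (δ / 2) A (f^[N] (e j)) (f^[N] (d j)) := fun j => by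
    have hmem := hmaps.iterate N (hd j).right_mem
    obtain ⟨l, hl⟩ := hconn _ (hmaps.iterate N (he j).right_mem) _ hmem
    have := modEq_of_chainIn_iterate hconn hmaps hδ2.le (he j) (hd j) hr hN1 hN1 hl
    rw [add_comm N l] at this
    exact hP j _ hmem A l hl (hAr.trans (this.add_right_cancel' N).symm) (hAP j)
  have htrace : ∀ j, ∀ M : ℕ, ∃ z ∈ vStable f C {y ∈ C | SimC f C e₀ y}, dist (y j) z ≤ ε ∧
      ∀ i ≤ M, dist (f^[N + i] (x j)) (f^[N + A + i] z) ≤ ε := by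
    intro j M
    obtain ⟨d', hd', hxd'⟩ := (hN (N + (M + 1)) (by omega)).1 j
    have hmem := hmaps.iterate (N + (M + 1)) hd'.right_mem
    obtain ⟨B, hB⟩ := hC.exists_forall_ge_chainIn hf hδ2 hmem
    set T := N + (A + (M + 1 + B)) with hT
    obtain ⟨e', he', hye'⟩ := (hN T (by omega)).2 j
    have hmem' := hmaps.iterate T he'.right_mem
    obtain ⟨l, hl⟩ := hconn _ hmem _ hmem'
    have hBl : B ≡ l [MOD m] := by
      have h1 := modEq_of_chainIn_iterate hconn hmaps hδ2.le hd' he' hr' (by omega) (by omega) hl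
      rw [show r' + T = N + (M + 1) + (r' + A + B) by rw [hT]; ring] at h1
      have h2 : r' + A + B ≡ 0 + B [MOD m] :=
        Nat.ModEq.add_right B ((hAr.add_left r').trans (add_comm r r' ▸ hrr))
      rw [zero_add] at h2
      exact ((Nat.ModEq.add_left_cancel' _ h1).trans h2).symm
    obtain ⟨w, hw0, hwx, hwy, hws⟩ := exists_pseudoOrbit (hye j).le (hchain j)
      ((dist_comm _ _).trans_le (hxd j).le) hxd'.le (hB _ hmem' B l hl hBl le_rfl)
      ((dist_comm _ _).trans_le hye'.le)
    have hwT : ∀ i ≥ T, w i = f^[i] (y' j) := fun i hi => by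
      have := hwy (i - T)
      rwa [show N + (A + (M + 1 + (B + (i - T)))) = i by omega,
        show T + (i - T) = i by omega] at this
    obtain ⟨z, hz, hzlim⟩ := hshadow w hws (tendsto_const_nhds.congr' (by
      filter_upwards [eventually_ge_atTop T] with i hi
      rw [hwT i hi, hwT (i + 1) (by omega), Function.iterate_succ_apply', dist_self]))
    refine ⟨z, mem_vStable_of_tendsto (hy'V j) (hzlim.congr' ?_), ?_, fun i hi => ?_⟩
    · filter_upwards [eventually_ge_atTop T] with i hi
      rw [hwT i hi]
    · have h1 := hz 0
      rw [hw0 0 hN1, dist_comm] at h1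
      simp only [Function.iterate_zero, id] at h1
      linarith [dist_triangle (y j) (y' j) z, hyy' j]
    · have h1 := hz (N + (A + i))
      rw [hwx i hi, dist_comm, ← add_assoc] at h1
      linarith
  have hlimit : ∀ j, ∃ z ∈ closure (vStable f C {y ∈ C | SimC f C e₀ y}), dist (y j) z ≤ ε ∧
      ∀ i, dist (f^[N + i] (x j)) (f^[N + A + i] z) ≤ ε := by
    intro j
    let Z : ℕ → Set X := fun M => closure (vStable f C {y ∈ C | SimC f C e₀ y}) ∩
      ({z | dist (y j) z ≤ ε} ∩
        ⋂ i, ⋂ (_ : i ≤ M), {z | dist (f^[N + i] (x j)) (f^[N + A + i] z) ≤ ε})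
    have hZ : ∀ M, IsClosed (Z M) := fun M => isClosed_closure.inter
      ((isClosed_le (by fun_prop) continuous_const).inter (isClosed_iInter fun i =>
        isClosed_iInter fun _ => isClosed_le
          (continuous_const.dist (hf.iterate _)) continuous_const))
    obtain ⟨z, hz⟩ := IsCompact.nonempty_iInter_of_sequence_nonempty_isCompact_isClosed Z
      (fun M z hz => ⟨hz.1, hz.2.1, mem_iInter₂.2 fun i hi =>
        mem_iInter₂.1 hz.2.2 i (by omega)⟩)
      (fun M => by
        obtain ⟨z, hzV, hyz, hz⟩ := htrace j M
        exact ⟨z, subset_closure hzV, hyz, mem_iInter₂.2 hz⟩)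
      (hZ 0).isCompact hZ
    rw [mem_iInter] at hz
    exact ⟨z, (hz 0).1, (hz 0).2.1, fun i => mem_iInter₂.1 (hz i).2.2 i le_rfl⟩
  choose z hzV hyz hz using hlimit
  exact ⟨z, N, N + A, hzV, hyz, hz⟩
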